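/- arXiv:1302.6097 — 2 statements merged into one kernel-verified Lean document; each statement's English description precedes it below -/
import Mathlib

section
/- There exists a constant C > 0 such that for all integers H ≥ 2, |#E_2(H) − ρ_2 · 2³ · H³| ≤ C · H² (log H)². -/
open Polynomial Filter

/-- `f ∈ ℤ[x]` is Eisenstein with respect to the prime `p`:
`p ∣ aᵢ` for all `i` below the degree, `p² ∤ a₀` and `p ∤ aₙ`. -/
def IsEisensteinWith (f : Polynomial ℤ) (p : ℕ) : Prop :=
  (∀ i < f.natDegree, (p : ℤ) ∣ f.coeff i) ∧ ¬ ((p : ℤ)^2 ∣ f.coeff 0) ∧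
    ¬ ((p : ℤ) ∣ f.leadingCoeff)
/-- `f` is an Eisenstein polynomial: it is Eisenstein with respect to some prime. -/
def IsEisenstein (f : Polynomial ℤ) : Prop :=
  ∃ p : ℕ, p.Prime ∧ IsEisensteinWith f p
/-- Height of an integer polynomial: the maximum of the absolute values of its coefficients. -/
def polyHeight (f : Polynomial ℤ) : ℕ :=
  (Finset.range (f.natDegree + 1)).sup fun i => (f.coeff i).natAbs
/-- `E_n(H)`: the set of Eisenstein polynomials of degree exactly `n` and height at most `H`. -/
def EisensteinSet (n H : ℕ) : Set (Polynomial ℤ) :=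
  {f | f.natDegree = n ∧ polyHeight f ≤ H ∧ IsEisenstein f}
/-- `ρₙ = 1 - ∏_p (1 - (p-1)²/pⁿ⁺²)`, the product running over all primes. -/
noncomputable def rho (n : ℕ) : ℝ :=
  1 - ∏' p : Nat.Primes, (1 - ((p : ℕ) - 1 : ℝ)^2 / ((p : ℕ) : ℝ)^(n + 2))

open ArithmeticFunction Finset

theorem sum_divisors_moebius (n : ℕ) :
    ∑ e ∈ n.divisors, moebius e = if n = 1 then 1 else 0 := by
  rw [← coe_mul_zeta_apply, moebius_mul_coe_zeta, one_apply]

theorem sum_divisors_moebius_div {d : ℕ} (hd : 0 < d) :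
    ∑ e ∈ d.divisors, (moebius e : ℝ) / e = (d.totient : ℝ) / d := by
  have key := (sum_eq_iff_sum_mul_moebius_eq (R := ℝ)
    (f := fun n => (n.totient : ℝ)) (g := fun n => (n : ℝ))).1
    (fun n _ => by exact_mod_cast Nat.sum_totient n) d hd
  rw [Nat.sum_divisorsAntidiagonal (fun x y => (moebius x : ℝ) * (y : ℝ))] at key
  rw [← key, sum_div]
  refine sum_congr rfl fun e he => ?_
  have hed := Nat.dvd_of_mem_divisors he
  have he0 : (e : ℝ) ≠ 0 := by exact_mod_cast (Nat.pos_of_mem_divisors he).ne'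
  have hd0 : (d : ℝ) ≠ 0 := by exact_mod_cast hd.ne'
  rw [Nat.cast_div hed he0]
  field_simp

/-- The multiples of `e` in `[-K, K]` are the dilates by `e` of `[-⌊K/e⌋, ⌊K/e⌋]`. -/
theorem filter_dvd_Icc_eq_image (K : ℕ) {e : ℕ} (he : 0 < e) :
    {a ∈ Icc (-(K : ℤ)) K | (e : ℤ) ∣ a} =
      (Icc (-((K / e : ℕ) : ℤ)) ((K / e : ℕ) : ℤ)).image fun k => (e : ℤ) * k := by
  have he' : (0 : ℤ) < e := by exact_mod_cast he
  ext a
  simp only [mem_filter, mem_Icc, mem_image, Int.natCast_ediv]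
  constructor
  · rintro ⟨⟨h1, h2⟩, k, rfl⟩
    refine ⟨k, ⟨?_, ?_⟩, rfl⟩
    · rw [neg_le, Int.le_ediv_iff_mul_le he']; linarith
    · rw [Int.le_ediv_iff_mul_le he']; linarith
  · rintro ⟨k, ⟨h1, h2⟩, rfl⟩
    rw [neg_le, Int.le_ediv_iff_mul_le he'] at h1
    rw [Int.le_ediv_iff_mul_le he'] at h2
    exact ⟨⟨by linarith, by linarith⟩, dvd_mul_right _ _⟩

theorem card_filter_dvd_Icc (K : ℕ) {e : ℕ} (he : 0 < e) :
    #{a ∈ Icc (-(K : ℤ)) K | (e : ℤ) ∣ a} = 2 * (K / e) + 1 := by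
  have he' : (e : ℤ) ≠ 0 := by exact_mod_cast he.ne'
  rw [filter_dvd_Icc_eq_image K he, card_image_of_injective _ (mul_right_injective₀ he'),
    Int.card_Icc]
  omega

/-- The number of integers in `[-K, K]` coprime to `d`. -/
noncomputable def coprimeCount (K d : ℕ) : ℕ := #{a ∈ Icc (-(K : ℤ)) K | a.natAbs.Coprime d}

theorem coprimeCount_le (K d : ℕ) : coprimeCount K d ≤ 2 * K + 1 := by
  refine (card_filter_le _ _).trans ?_
  rw [Int.card_Icc]
  omega

theorem coprimeCount_eq_sum (K : ℕ) {d : ℕ} (hd : 0 < d) :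
    (coprimeCount K d : ℤ) = ∑ e ∈ d.divisors, moebius e * (2 * (K / e : ℕ) + 1) := by
  have indicator (a : ℤ) : (if a.natAbs.Coprime d then (1 : ℤ) else 0) =
      ∑ e ∈ d.divisors, if (e : ℤ) ∣ a then moebius e else 0 := by
    have hdiv : (a.natAbs.gcd d).divisors = d.divisors.filter fun e : ℕ => (e : ℤ) ∣ a := by
      ext e
      simp only [Nat.mem_divisors, mem_filter, Nat.dvd_gcd_iff, Int.natCast_dvd]
      have := Nat.gcd_pos_of_pos_right a.natAbs hd
      constructor
      · rintro ⟨⟨h1, h2⟩, -⟩; exact ⟨⟨h2, hd.ne'⟩, h1⟩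
      · rintro ⟨⟨h2, -⟩, h1⟩; exact ⟨⟨h1, h2⟩, this.ne'⟩
    rw [← sum_filter, ← hdiv, sum_divisors_moebius]
  rw [coprimeCount, card_filter]
  push_cast
  simp only [indicator]
  rw [sum_comm]
  refine sum_congr rfl fun e he => ?_
  rw [← sum_filter, sum_const, card_filter_dvd_Icc K (Nat.pos_of_mem_divisors he)]
  simp [mul_comm]

theorem abs_two_mul_div_add_one_sub_le (K : ℕ) {e : ℕ} (he : 0 < e) :
    |(2 * ((K / e : ℕ) : ℝ) + 1) - 2 * K / e| ≤ 1 := by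
  have he' : (0 : ℝ) < e := by exact_mod_cast he
  have h1 : ((K / e : ℕ) : ℝ) ≤ K / e := Nat.cast_div_le
  have h2 : (K : ℝ) / e < (K / e : ℕ) + 1 := by
    rw [div_lt_iff₀ he']
    exact_mod_cast Nat.lt_mul_of_div_lt (Nat.lt_succ_self _) he
  rw [mul_div_assoc, abs_le]
  constructor <;> linarith

theorem abs_coprimeCount_sub_le (K : ℕ) {d : ℕ} (hd : 0 < d) :
    |(coprimeCount K d : ℝ) - 2 * K * (d.totient / d)| ≤ #d.divisors := by
  have h : (coprimeCount K d : ℝ) =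
      ∑ e ∈ d.divisors, (moebius e : ℝ) * (2 * (K / e : ℕ) + 1) := by
    have := congrArg (Int.cast : ℤ → ℝ) (coprimeCount_eq_sum K hd)
    push_cast at this
    exact this
  rw [h, ← sum_divisors_moebius_div hd, mul_sum, ← sum_sub_distrib, card_eq_sum_ones,
    Nat.cast_sum]
  refine (abs_sum_le_sum_abs _ _).trans (sum_le_sum fun e he => ?_)
  have hmu : |(moebius e : ℝ)| ≤ 1 := by exact_mod_cast abs_moebius_le_one (n := e)
  have := abs_two_mul_div_add_one_sub_le K (Nat.pos_of_mem_divisors he)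
  calc |(moebius e : ℝ) * (2 * (K / e : ℕ) + 1) - 2 * K * (moebius e / e)|
      = |(moebius e : ℝ)| * |(2 * ((K / e : ℕ) : ℝ) + 1) - 2 * K / e| := by
        rw [← abs_mul]; congr 1; ring
    _ ≤ 1 * 1 := by gcongr
    _ = ((1 : ℕ) : ℝ) := by norm_num

/-- The number of triples in `[-H, H]³` that are Eisenstein at every prime factor of a
squarefree `d`. -/
noncomputable def localCount (H d : ℕ) : ℕ :=
  coprimeCount H d * (2 * (H / d) + 1) * coprimeCount (H / d) d

/-- The density of triples that are Eisenstein at every prime factor of a squarefree `d`. -/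
noncomputable def localDensity (d : ℕ) : ℝ := (d.totient : ℝ) ^ 2 / (d : ℝ) ^ 4

theorem abs_localCount_sub_le {H d : ℕ} (hd : 0 < d) (hdH : d ≤ H) :
    |(localCount H d : ℝ) - 8 * H ^ 3 * localDensity d| ≤
      27 * (H : ℝ) ^ 2 * ((#d.divisors : ℝ) / d) := by
  have hd1 : (1 : ℝ) ≤ d := by exact_mod_cast hd
  have hd0 : (0 : ℝ) < d := by linarith
  have hH1 : (1 : ℝ) ≤ H := by exact_mod_cast hd.trans_le hdH
  have hτ : (1 : ℝ) ≤ #d.divisors := by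
    exact_mod_cast card_pos.2 ⟨d, Nat.mem_divisors_self d hd.ne'⟩
  have hK : 1 ≤ H / d := (Nat.one_le_div_iff hd).2 hdH
  have hK' : ((H / d : ℕ) : ℝ) ≤ H / d := Nat.cast_div_le
  have hφ : (d.totient : ℝ) / d ≤ 1 := by
    rw [div_le_one hd0]; exact_mod_cast Nat.totient_le d
  have hφ0 : 0 ≤ (d.totient : ℝ) / d := by positivity
  have e1 := abs_coprimeCount_sub_le H hd
  have e2 := abs_two_mul_div_add_one_sub_le H hd
  have e3 := abs_coprimeCount_sub_le (H / d) hd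
  have b3 : (coprimeCount (H / d) d : ℝ) ≤ 2 * (H / d : ℕ) + 1 := by
    exact_mod_cast coprimeCount_le (H / d) d
  have hK1 : (1 : ℝ) ≤ (H / d : ℕ) := by exact_mod_cast hK
  simp only [localCount, localDensity]
  push_cast
  generalize ((H / d : ℕ) : ℝ) = K at *
  generalize (coprimeCount H d : ℝ) = x at *
  have hz0 : (0 : ℝ) ≤ coprimeCount (H / d) d := Nat.cast_nonneg _
  generalize (coprimeCount (H / d) d : ℝ) = z at *
  generalize (#d.divisors : ℝ) = τ at *
  have hr : 8 * (H : ℝ) ^ 3 * ((d.totient : ℝ) ^ 2 / (d : ℝ) ^ 4) =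
      (2 * H * (d.totient / d)) * (2 * H / d) * (2 * H / d * (d.totient / d)) := by
    field_simp; norm_num
  rw [hr]
  generalize (d.totient : ℝ) / d = r at *
  have e3' : |z - 2 * H / d * r| ≤ 3 * τ := by
    have : |2 * K * r - 2 * H / d * r| ≤ 2 := by
      rw [← sub_mul, abs_mul, abs_of_nonneg hφ0]
      have : |2 * K - 2 * H / d| ≤ 2 := by
        rw [abs_le] at e2 ⊢; constructor <;> linarith
      nlinarith [abs_nonneg (2 * K - 2 * (H : ℝ) / d)]
    calc |z - 2 * H / d * r| ≤ |z - 2 * K * r| + |2 * K * r - 2 * H / d * r| :=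
          abs_sub_le _ _ _
      _ ≤ 3 * τ := by linarith
  have hq : 0 ≤ (H : ℝ) / d := by positivity
  have hqH : (H : ℝ) / d ≤ H := div_le_self (by linarith) hd1
  have hgoal : 27 * (H : ℝ) ^ 2 * (τ / d) = 27 * H * (H / d) * τ := by ring
  rw [hgoal]
  rw [mul_div_assoc] at e2 e3' ⊢
  generalize (H : ℝ) / d = q at *
  have hid : x * (2 * K + 1) * z - 2 * H * r * (2 * q) * (2 * q * r) =
      (x - 2 * H * r) * (2 * K + 1) * z + (2 * H * r) * (2 * K + 1 - 2 * q) * z +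
        (2 * H * r) * (2 * q) * (z - 2 * q * r) := by ring
  have hy1 : |2 * (H : ℝ) * r| ≤ 2 * H := by
    rw [abs_of_nonneg (by positivity)]; nlinarith
  have hx2 : |2 * K + 1| ≤ 3 * q := by
    rw [abs_of_nonneg (by positivity)]; linarith
  have hx3 : |z| ≤ 3 * q := by
    rw [abs_of_nonneg hz0]; linarith
  have hy2 : |2 * q| ≤ 2 * q := by rw [abs_of_nonneg (by positivity)]
  rw [hid]
  refine (abs_add_three _ _ _).trans ?_
  simp only [abs_mul _ (_ * _), abs_mul _ z, abs_mul _ (z - _), abs_mul _ (2 * K + 1),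
    abs_mul _ (2 * K + 1 - 2 * q)]
  calc _ ≤ τ * (3 * q) * (3 * q) + (2 * H) * 1 * (3 * q) + (2 * H) * (2 * q) * (3 * τ) := by
        gcongr
    _ ≤ τ * (3 * q) * (3 * H) + (2 * H) * τ * (3 * q) + (2 * H) * (2 * q) * (3 * τ) := by
        gcongr
    _ = 27 * H * q * τ := by ring

theorem sum_card_divisors_div_le (H : ℕ) :
    ∑ d ∈ Icc 1 H, (#d.divisors : ℝ) / d ≤ (1 + Real.log H) ^ 2 := by
  have hharm : ∑ d ∈ Icc 1 H, (d : ℝ)⁻¹ ≤ 1 + Real.log H := by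
    have := harmonic_le_one_add_log H
    rw [harmonic_eq_sum_Icc] at this
    push_cast at this
    exact this
  have hexp : ∀ d ∈ Icc 1 H, (#d.divisors : ℝ) / d =
      ∑ x ∈ d.divisorsAntidiagonal, (x.1 : ℝ)⁻¹ * (x.2 : ℝ)⁻¹ := by
    intro d _
    rw [← Nat.map_div_right_divisors, sum_map, card_eq_sum_ones, Nat.cast_sum, sum_div]
    refine sum_congr rfl fun e he => ?_
    have he0 : (e : ℝ) ≠ 0 := by exact_mod_cast (Nat.pos_of_mem_divisors he).ne'
    change ((1 : ℕ) : ℝ) / d = (e : ℝ)⁻¹ * ((d / e : ℕ) : ℝ)⁻¹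
    rw [Nat.cast_div (Nat.dvd_of_mem_divisors he) he0]
    field_simp
    simp
  rw [sum_congr rfl hexp, sum_sigma' (Icc 1 H) fun d => d.divisorsAntidiagonal]
  calc _ = ∑ x ∈ ((Icc 1 H).sigma fun d => d.divisorsAntidiagonal).image Sigma.snd,
        (x.1 : ℝ)⁻¹ * (x.2 : ℝ)⁻¹ := by
        rw [sum_image]
        rintro ⟨d, x⟩ hx ⟨d', x'⟩ hx' (rfl : x = x')
        simp only [coe_sigma, Set.mem_sigma_iff, mem_coe, Nat.mem_divisorsAntidiagonal] at hx hx'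
        obtain rfl : d = d' := hx.2.1.symm.trans hx'.2.1
        rfl
    _ ≤ ∑ x ∈ Icc 1 H ×ˢ Icc 1 H, (x.1 : ℝ)⁻¹ * (x.2 : ℝ)⁻¹ := by
        refine sum_le_sum_of_subset_of_nonneg ?_ fun _ _ _ => by positivity
        rintro ⟨a, b⟩ hx
        simp only [mem_image, mem_sigma, mem_Icc, Nat.mem_divisorsAntidiagonal] at hx
        obtain ⟨⟨d, x⟩, ⟨⟨-, hdH⟩, hprod, hd0⟩, rfl⟩ := hx
        simp only at hprod hd0 hdH
        subst hprod
        have ha := Nat.pos_of_ne_zero (left_ne_zero_of_mul hd0)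
        have hb := Nat.pos_of_ne_zero (right_ne_zero_of_mul hd0)
        simp only [mem_product, mem_Icc]
        exact ⟨⟨ha, (Nat.le_mul_of_pos_right _ hb).trans hdH⟩,
          ⟨hb, (Nat.le_mul_of_pos_left _ ha).trans hdH⟩⟩
    _ = (∑ d ∈ Icc 1 H, (d : ℝ)⁻¹) ^ 2 := by rw [sq, sum_mul_sum, sum_product]
    _ ≤ _ := by gcongr

theorem abs_moebius_mul_localDensity_le (d : ℕ) :
    |(moebius d : ℝ) * localDensity d| ≤ ((d : ℝ) ^ 2)⁻¹ := by
  rcases Nat.eq_zero_or_pos d with rfl | hd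
  · simp
  have hd0 : (0 : ℝ) < d := by exact_mod_cast hd
  have hmu : |(moebius d : ℝ)| ≤ 1 := by exact_mod_cast abs_moebius_le_one (n := d)
  have hφ : (d.totient : ℝ) ≤ d := by exact_mod_cast Nat.totient_le d
  have hpos : 0 ≤ localDensity d := by unfold localDensity; positivity
  rw [abs_mul, abs_of_nonneg hpos]
  calc _ ≤ 1 * ((d : ℝ) ^ 2 / d ^ 4) := by unfold localDensity; gcongr
    _ = _ := by field_simp

theorem summable_abs_moebius_mul_localDensity :
    Summable fun d : ℕ => |(moebius d : ℝ) * localDensity d| :=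
  (Real.summable_nat_pow_inv.2 one_lt_two).of_nonneg_of_le (fun _ => abs_nonneg _)
    abs_moebius_mul_localDensity_le

theorem one_sub_rho_two : 1 - rho 2 = ∑' d : ℕ, (moebius d : ℝ) * localDensity d := by
  have hprod := EulerProduct.eulerProduct_hasProd
    (f := fun d : ℕ => (moebius d : ℝ) * localDensity d) (by simp [localDensity])
    (fun {m n} hmn => by
      simp only [localDensity, Nat.totient_mul hmn,
        isMultiplicative_moebius.map_mul_of_coprime hmn]
      push_cast
      ring) (by simpa using summable_abs_moebius_mul_localDensity) (by simp)
  rw [rho, sub_sub_cancel, ← hprod.tprod_eq]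
  refine tprod_congr fun p => ?_
  have hp := p.2
  rw [tsum_eq_sum (s := range 2)]
  · simp only [sum_range_succ, range_zero, sum_empty, pow_zero, pow_one,
      moebius_apply_prime hp, localDensity, Nat.totient_prime hp, Nat.cast_sub hp.one_le]
    simp [sub_eq_add_neg]
  · intro e he
    have he2 : ¬ e < 2 := by simpa using he
    rw [moebius_apply_prime_pow hp (by omega), if_neg (by omega)]
    simp

theorem abs_tsum_sub_sum_range_le {f : ℕ → ℝ} (hf : ∀ d, |f d| ≤ ((d : ℝ) ^ 2)⁻¹) {H : ℕ}
    (hH : 0 < H) : |∑' d, f d - ∑ d ∈ range (H + 1), f d| ≤ 2 / H := by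
  have hs : Summable fun d => |f d| :=
    (Real.summable_nat_pow_inv.2 one_lt_two).of_nonneg_of_le (fun _ => abs_nonneg _) hf
  have hs' : Summable fun d => |f (d + (H + 1))| :=
    hs.comp_injective (add_left_injective (H + 1))
  have hH' : (0 : ℝ) < H := by exact_mod_cast hH
  have hpartial (n : ℕ) : ∑ i ∈ range n, |f (i + (H + 1))| ≤ 2 / H :=
    calc _ ≤ ∑ i ∈ range n, (((i + (H + 1) : ℕ) : ℝ) ^ 2)⁻¹ :=
          sum_le_sum fun i _ => hf (i + (H + 1))
      _ = ∑ i ∈ Ioo H (n + (H + 1)), ((i : ℝ) ^ 2)⁻¹ := by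
          rw [range_eq_Ico, sum_Ico_add' (fun i : ℕ => ((i : ℝ) ^ 2)⁻¹) 0 n (H + 1)]
          refine sum_congr ?_ fun _ _ => rfl
          ext
          simp only [mem_Ico, mem_Ioo]
          omega
      _ ≤ 2 / (H + 1) := sum_Ioo_inv_sq_le _ _
      _ ≤ 2 / H := by gcongr; linarith
  rw [← hs.of_abs.sum_add_tsum_nat_add (H + 1), add_sub_cancel_left]
  exact (norm_tsum_le_tsum_norm (f := fun d => f (d + (H + 1))) hs').trans
    (hs'.tsum_le_of_sum_range_le hpartial)

theorem abs_one_sub_rho_two_sub_sum_le {H : ℕ} (hH : 0 < H) :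
    |(1 - rho 2) - ∑ d ∈ Icc 1 H, (moebius d : ℝ) * localDensity d| ≤ 2 / H := by
  have hset : ∑ d ∈ Icc 1 H, (moebius d : ℝ) * localDensity d =
      ∑ d ∈ range (H + 1), (moebius d : ℝ) * localDensity d := by
    refine sum_subset (fun d hd => ?_) fun d hd hd' => ?_
    · simp only [mem_Icc, mem_range] at hd ⊢; omega
    · simp only [mem_Icc, mem_range] at hd hd'
      obtain rfl : d = 0 := by omega
      simp
  rw [one_sub_rho_two, hset]
  exact abs_tsum_sub_sum_range_le abs_moebius_mul_localDensity_le hH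

/-- The triple `(a, b, c)` satisfies the Eisenstein conditions at `p` for `a x² + b x + c`. -/
def IsEisensteinTriple (t : ℤ × ℤ × ℤ) (p : ℕ) : Prop :=
  (p : ℤ) ∣ t.2.1 ∧ ((p : ℤ) ∣ t.2.2 ∧ ¬ (p : ℤ) ^ 2 ∣ t.2.2) ∧ ¬ (p : ℤ) ∣ t.1

/-- The coefficient triples of height at most `H`. -/
noncomputable def tripleBox (H : ℕ) : Finset (ℤ × ℤ × ℤ) :=
  Icc (-(H : ℤ)) H ×ˢ Icc (-(H : ℤ)) H ×ˢ Icc (-(H : ℤ)) H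

theorem IsEisensteinTriple.ne_zero {t : ℤ × ℤ × ℤ} {p : ℕ} (h : IsEisensteinTriple t p) :
    t.2.2 ≠ 0 := fun h0 => h.2.1.2 (h0 ▸ dvd_zero _)

open Classical in
/-- The primes up to `H` at which a triple is Eisenstein. -/
noncomputable def eisensteinPrimes (H : ℕ) (t : ℤ × ℤ × ℤ) : Finset ℕ :=
  {p ∈ range (H + 1) | p.Prime ∧ IsEisensteinTriple t p}

/-- The product of the primes up to `H` at which a triple is Eisenstein. -/
noncomputable def eisensteinProd (H : ℕ) (t : ℤ × ℤ × ℤ) : ℕ := ∏ p ∈ eisensteinPrimes H t, p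

theorem mem_eisensteinPrimes {H p : ℕ} {t : ℤ × ℤ × ℤ} :
    p ∈ eisensteinPrimes H t ↔ p ≤ H ∧ p.Prime ∧ IsEisensteinTriple t p := by
  simp [eisensteinPrimes]

theorem primeFactors_eisensteinProd (H : ℕ) (t : ℤ × ℤ × ℤ) :
    (eisensteinProd H t).primeFactors = eisensteinPrimes H t :=
  Nat.primeFactors_prod fun _ hp => (mem_eisensteinPrimes.1 hp).2.1

theorem eisensteinProd_ne_zero (H : ℕ) (t : ℤ × ℤ × ℤ) : eisensteinProd H t ≠ 0 :=
  prod_ne_zero_iff.2 fun _ hp => (mem_eisensteinPrimes.1 hp).2.1.ne_zero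

theorem eisensteinProd_le {H : ℕ} (hH : 0 < H) {t : ℤ × ℤ × ℤ} (ht : t ∈ tripleBox H) :
    eisensteinProd H t ≤ H := by
  rcases (eisensteinPrimes H t).eq_empty_or_nonempty with h | ⟨p, hp⟩
  · rw [eisensteinProd, h, prod_empty]; exact hH
  have hc := (mem_eisensteinPrimes.1 hp).2.2.ne_zero
  have hdvd : eisensteinProd H t ∣ t.2.2.natAbs :=
    prod_primes_dvd _ (fun q hq => (mem_eisensteinPrimes.1 hq).2.1.prime)
      fun q hq => Int.natCast_dvd.1 (mem_eisensteinPrimes.1 hq).2.2.2.1.1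
  have := Nat.le_of_dvd (by omega) hdvd
  simp only [tripleBox, mem_product, mem_Icc] at ht
  omega

theorem eisensteinProd_ne_one_iff {H : ℕ} {t : ℤ × ℤ × ℤ} (ht : t ∈ tripleBox H) :
    eisensteinProd H t ≠ 1 ↔ ∃ p : ℕ, p.Prime ∧ IsEisensteinTriple t p := by
  have h : eisensteinProd H t ≠ 1 ↔ (eisensteinPrimes H t).Nonempty := by
    rw [← primeFactors_eisensteinProd, Nat.nonempty_primeFactors]
    have := eisensteinProd_ne_zero H t
    omega
  rw [h]
  constructor
  · rintro ⟨p, hp⟩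
    exact ⟨p, (mem_eisensteinPrimes.1 hp).2⟩
  · rintro ⟨p, hp, hpt⟩
    have hc := hpt.ne_zero
    have := Nat.le_of_dvd (by omega) (Int.natCast_dvd.1 hpt.2.1.1)
    simp only [tripleBox, mem_product, mem_Icc] at ht
    exact ⟨p, mem_eisensteinPrimes.2 ⟨by omega, hp, hpt⟩⟩

theorem Squarefree.dvd_iff_primeFactors_dvd {d : ℕ} (hd : Squarefree d) (n : ℕ) :
    d ∣ n ↔ ∀ p ∈ d.primeFactors, p ∣ n := by
  refine ⟨fun h p hp => (Nat.dvd_of_mem_primeFactors hp).trans h, fun h => ?_⟩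
  rw [← Nat.prod_primeFactors_of_squarefree hd]
  exact prod_primes_dvd _ (fun q hq => (Nat.prime_of_mem_primeFactors hq).prime) h

theorem coprime_iff_primeFactors_not_dvd {d : ℕ} (hd : d ≠ 0) (n : ℕ) :
    n.Coprime d ↔ ∀ p ∈ d.primeFactors, ¬ p ∣ n := by
  rw [← not_iff_not, Nat.Prime.not_coprime_iff_dvd]
  simp only [Nat.mem_primeFactors]
  push Not
  exact ⟨fun ⟨p, hp, h1, h2⟩ => ⟨p, ⟨hp, h2, hd⟩, h1⟩,
    fun ⟨p, ⟨hp, h2, _⟩, h1⟩ => ⟨p, hp, h1, h2⟩⟩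

theorem Squarefree.sq_dvd_mul_iff {d p : ℕ} (hd : Squarefree d) (hp : p.Prime) (hpd : p ∣ d)
    (k : ℕ) : p ^ 2 ∣ d * k ↔ p ∣ k := by
  obtain ⟨m, rfl⟩ := hpd
  have hm : ¬ p ∣ m := fun ⟨l, hl⟩ =>
    hp.one_lt.ne' (Nat.isUnit_iff.1 (hd p ⟨l, by rw [hl, mul_assoc]⟩))
  rw [sq, mul_assoc, Nat.mul_dvd_mul_iff_left hp.pos, hp.dvd_mul]
  simp [hm]

theorem dvd_eisensteinProd_iff {H d : ℕ} (hd : Squarefree d) (hdH : d ≤ H) (t : ℤ × ℤ × ℤ) :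
    d ∣ eisensteinProd H t ↔ t.1.natAbs.Coprime d ∧ (d : ℤ) ∣ t.2.1 ∧
      ((d : ℤ) ∣ t.2.2 ∧ ∀ p ∈ d.primeFactors, ¬ (p : ℤ) ^ 2 ∣ t.2.2) := by
  have h : d ∣ eisensteinProd H t ↔ ∀ p ∈ d.primeFactors, IsEisensteinTriple t p := by
    rw [hd.dvd_iff_primeFactors_dvd]
    refine forall₂_congr fun p hp => ?_
    have hp' := Nat.prime_of_mem_primeFactors hp
    have hpH : p ≤ H := (Nat.le_of_mem_primeFactors hp).trans hdH
    calc p ∣ eisensteinProd H t ↔ p ∈ (eisensteinProd H t).primeFactors := by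
          simp [hp', eisensteinProd_ne_zero]
      _ ↔ _ := by simp [primeFactors_eisensteinProd, mem_eisensteinPrimes, hp', hpH]
  rw [h, Int.natCast_dvd, Int.natCast_dvd, hd.dvd_iff_primeFactors_dvd,
    hd.dvd_iff_primeFactors_dvd, coprime_iff_primeFactors_not_dvd hd.ne_zero]
  simp only [IsEisensteinTriple, Int.natCast_dvd, forall_and]
  tauto

theorem filter_dvd_not_sq_dvd_Icc_eq_image (H : ℕ) {d : ℕ} (hd : Squarefree d) :
    {c ∈ Icc (-(H : ℤ)) H | (d : ℤ) ∣ c ∧ ∀ p ∈ d.primeFactors, ¬ (p : ℤ) ^ 2 ∣ c} =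
      {k ∈ Icc (-((H / d : ℕ) : ℤ)) ((H / d : ℕ) : ℤ) | k.natAbs.Coprime d}.image
        fun k => (d : ℤ) * k := by
  rw [← filter_filter, filter_dvd_Icc_eq_image H (Nat.pos_of_ne_zero hd.ne_zero), filter_image]
  congr 1
  refine filter_congr fun k _ => ?_
  rw [coprime_iff_primeFactors_not_dvd hd.ne_zero]
  refine forall₂_congr fun p hp => not_congr ?_
  rw [← hd.sq_dvd_mul_iff (Nat.prime_of_mem_primeFactors hp) (Nat.dvd_of_mem_primeFactors hp),
    ← Nat.cast_pow, Int.natCast_dvd, Int.natAbs_mul, Int.natAbs_natCast]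

theorem card_filter_dvd_eisensteinProd {H d : ℕ} (hd : Squarefree d) (hdH : d ≤ H) :
    #{t ∈ tripleBox H | d ∣ eisensteinProd H t} = localCount H d := by
  have hd0 : (d : ℤ) ≠ 0 := by exact_mod_cast hd.ne_zero
  simp only [dvd_eisensteinProd_iff hd hdH, tripleBox]
  rw [filter_product (fun a : ℤ => a.natAbs.Coprime d)
      (fun x : ℤ × ℤ => (d : ℤ) ∣ x.1 ∧
        ((d : ℤ) ∣ x.2 ∧ ∀ p ∈ d.primeFactors, ¬ (p : ℤ) ^ 2 ∣ x.2)),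
    filter_product (fun b : ℤ => (d : ℤ) ∣ b)
      (fun c : ℤ => (d : ℤ) ∣ c ∧ ∀ p ∈ d.primeFactors, ¬ (p : ℤ) ^ 2 ∣ c),
    card_product, card_product, filter_dvd_not_sq_dvd_Icc_eq_image H hd,
    card_image_of_injective _ (mul_right_injective₀ hd0),
    card_filter_dvd_Icc H (Nat.pos_of_ne_zero hd.ne_zero), ← mul_assoc]
  rfl

theorem card_filter_eisensteinProd_eq_one {H : ℕ} (hH : 0 < H) :
    (#{t ∈ tripleBox H | eisensteinProd H t = 1} : ℤ) =
      ∑ d ∈ Icc 1 H, moebius d * localCount H d := by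
  have indicator : ∀ t ∈ tripleBox H, (if eisensteinProd H t = 1 then (1 : ℤ) else 0) =
      ∑ d ∈ Icc 1 H, if d ∣ eisensteinProd H t then moebius d else 0 := by
    intro t ht
    rw [← sum_divisors_moebius, ← sum_filter]
    refine sum_congr ?_ fun _ _ => rfl
    ext d
    have h0 := eisensteinProd_ne_zero H t
    simp only [Nat.mem_divisors, mem_filter, mem_Icc]
    refine ⟨fun h => ⟨⟨Nat.pos_of_dvd_of_pos h.1 (by omega), ?_⟩, h.1⟩, fun h => ⟨h.2, h0⟩⟩
    exact (Nat.le_of_dvd (by omega) h.1).trans (eisensteinProd_le hH ht)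
  rw [card_filter]
  push_cast
  rw [sum_congr rfl indicator, sum_comm]
  refine sum_congr rfl fun d hd => ?_
  by_cases hsq : Squarefree d
  · rw [← sum_filter, sum_const, card_filter_dvd_eisensteinProd hsq (mem_Icc.1 hd).2]
    simp [mul_comm]
  · simp [moebius_eq_zero_of_not_squarefree hsq]

/-- The quadratic polynomial with coefficients `(a, b, c)`. -/
noncomputable def quadratic (t : ℤ × ℤ × ℤ) : ℤ[X] := C t.1 * X ^ 2 + C t.2.1 * X + C t.2.2

theorem coeff_two_quadratic (t : ℤ × ℤ × ℤ) : (quadratic t).coeff 2 = t.1 := by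
  simp only [quadratic, coeff_add, coeff_C_mul, coeff_X_pow, coeff_X, coeff_C]
  norm_num

theorem coeff_one_quadratic (t : ℤ × ℤ × ℤ) : (quadratic t).coeff 1 = t.2.1 := by
  simp only [quadratic, coeff_add, coeff_C_mul, coeff_X_pow, coeff_X, coeff_C]
  norm_num

theorem coeff_zero_quadratic (t : ℤ × ℤ × ℤ) : (quadratic t).coeff 0 = t.2.2 := by
  simp [quadratic]

theorem quadratic_injective : Function.Injective quadratic := by
  intro t t' h
  refine Prod.ext ?_ (Prod.ext ?_ ?_)
  · rw [← coeff_two_quadratic, h, coeff_two_quadratic]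
  · rw [← coeff_one_quadratic, h, coeff_one_quadratic]
  · rw [← coeff_zero_quadratic, h, coeff_zero_quadratic]

theorem quadratic_mem_eisensteinSet_iff {H : ℕ} {t : ℤ × ℤ × ℤ} (ha : t.1 ≠ 0) :
    quadratic t ∈ EisensteinSet 2 H ↔
      t ∈ tripleBox H ∧ ∃ p : ℕ, p.Prime ∧ IsEisensteinTriple t p := by
  have hdeg : (quadratic t).natDegree = 2 := natDegree_quadratic ha
  simp only [EisensteinSet, Set.mem_ofPred_eq, polyHeight, IsEisenstein, IsEisensteinWith,
    leadingCoeff, hdeg, Finset.sup_le_iff, mem_range, IsEisensteinTriple, tripleBox, mem_product,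
    mem_Icc, Nat.forall_lt_succ_right, Nat.not_lt_zero, IsEmpty.forall_iff, implies_true, true_and,
    coeff_zero_quadratic, coeff_one_quadratic, coeff_two_quadratic]
  refine and_congr (by omega) (exists_congr fun p => ?_)
  tauto

theorem eisensteinSet_two_eq_image (H : ℕ) :
    EisensteinSet 2 H = quadratic '' {t ∈ tripleBox H | eisensteinProd H t ≠ 1} := by
  ext f
  constructor
  · intro hf
    have hdeg : f.natDegree = 2 := hf.1
    have hquad : quadratic (f.coeff 2, f.coeff 1, f.coeff 0) = f :=
      (eq_quadratic_of_degree_le_two (natDegree_le_iff_degree_le.1 hdeg.le)).symm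
    have hlead : f.coeff 2 ≠ 0 := by
      rw [← hdeg]
      exact leadingCoeff_ne_zero.2 (by rintro rfl; simp at hdeg)
    rw [← hquad, quadratic_mem_eisensteinSet_iff hlead] at hf
    exact ⟨_, ⟨hf.1, (eisensteinProd_ne_one_iff hf.1).2 hf.2⟩, hquad⟩
  · rintro ⟨t, ⟨ht, hne⟩, rfl⟩
    obtain ⟨p, hp, hpt⟩ := (eisensteinProd_ne_one_iff ht).1 hne
    have ha : t.1 ≠ 0 := fun h => hpt.2.2 (h ▸ dvd_zero _)
    exact (quadratic_mem_eisensteinSet_iff ha).2 ⟨ht, p, hp, hpt⟩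

theorem natCard_eisensteinSet_two {H : ℕ} (hH : 0 < H) :
    (Nat.card (EisensteinSet 2 H) : ℝ) =
      (2 * H + 1) ^ 3 - ∑ d ∈ Icc 1 H, (moebius d : ℝ) * localCount H d := by
  have hcard : Nat.card (EisensteinSet 2 H) = #{t ∈ tripleBox H | eisensteinProd H t ≠ 1} := by
    rw [eisensteinSet_two_eq_image, Nat.card_coe_set_eq,
      Set.ncard_image_of_injective _ quadratic_injective, ← Set.ncard_coe_finset]
    simp
  have hbox : #(tripleBox H) = (2 * H + 1) ^ 3 := by
    have : #(Icc (-(H : ℤ)) H) = 2 * H + 1 := by rw [Int.card_Icc]; omega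
    rw [tripleBox, card_product, card_product, this]
    ring
  have hsplit :=
    card_filter_add_card_filter_not (s := tripleBox H) (fun t => eisensteinProd H t = 1)
  have hone := congrArg (Int.cast : ℤ → ℝ) (card_filter_eisensteinProd_eq_one hH)
  push_cast at hone
  rw [hcard, ← hone, eq_sub_iff_add_eq, add_comm]
  rw [hbox] at hsplit
  exact_mod_cast hsplit

/-- `#E₂(H) = ρ₂ 2³ H³ + O(H² (log H)²)`. -/
theorem card_eisensteinSet_two :
    ∃ C : ℝ, 0 < C ∧ ∀ H : ℕ, 2 ≤ H →
      |(Nat.card (EisensteinSet 2 H) : ℝ) - rho 2 * 2^3 * (H : ℝ)^3| ≤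
        C * (H : ℝ)^2 * (Real.log H)^2 := by
  refine ⟨400, by norm_num, fun H hH => ?_⟩
  have hH2 : (2 : ℝ) ≤ H := by exact_mod_cast hH
  have hlog : 1 ≤ 2 * Real.log H := by
    have := Real.log_le_log two_pos hH2
    linarith [Real.log_two_gt_d9]
  have hlocal : |∑ d ∈ Icc 1 H, (moebius d : ℝ) * localCount H d -
      8 * H ^ 3 * ∑ d ∈ Icc 1 H, (moebius d : ℝ) * localDensity d| ≤
        27 * (H : ℝ) ^ 2 * (1 + Real.log H) ^ 2 := by
    rw [mul_sum, ← sum_sub_distrib]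
    refine (abs_sum_le_sum_abs _ _).trans ?_
    refine le_trans (sum_le_sum fun d hd => ?_)
      ((mul_sum _ _ _).symm.le.trans
        (mul_le_mul_of_nonneg_left (sum_card_divisors_div_le H) (by positivity)))
    have hmu : |(moebius d : ℝ)| ≤ 1 := by exact_mod_cast abs_moebius_le_one (n := d)
    calc _ = |(moebius d : ℝ)| * |(localCount H d : ℝ) - 8 * H ^ 3 * localDensity d| := by
          rw [← abs_mul]; congr 1; ring
      _ ≤ 1 * _ := by
          gcongr
          exact abs_localCount_sub_le (mem_Icc.1 hd).1 (mem_Icc.1 hd).2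
      _ = _ := one_mul _
  have htail := abs_one_sub_rho_two_sub_sum_le (H := H) (by omega)
  rw [natCard_eisensteinSet_two (by omega)]
  generalize ∑ d ∈ Icc 1 H, (moebius d : ℝ) * localCount H d = S at *
  generalize ∑ d ∈ Icc 1 H, (moebius d : ℝ) * localDensity d = T at *
  have htail' : |8 * (H : ℝ) ^ 3 * (1 - rho 2 - T)| ≤ 16 * (H : ℝ) ^ 2 := by
    rw [abs_mul, abs_of_nonneg (by positivity)]
    calc _ ≤ 8 * (H : ℝ) ^ 3 * (2 / H) := by gcongr
      _ = _ := by field_simp; norm_num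
  have hid : (2 * (H : ℝ) + 1) ^ 3 - S - rho 2 * 2 ^ 3 * H ^ 3 =
      (12 * H ^ 2 + 6 * H + 1) - (S - 8 * H ^ 3 * T) + 8 * H ^ 3 * (1 - rho 2 - T) := by ring
  have hbound : |(2 * (H : ℝ) + 1) ^ 3 - S - rho 2 * 2 ^ 3 * H ^ 3| ≤
      H ^ 2 * (35 + 27 * (1 + Real.log H) ^ 2) := by
    rw [hid]
    rw [abs_le] at hlocal htail' ⊢
    constructor <;> nlinarith
  refine hbound.trans ?_
  rw [mul_comm (400 : ℝ), mul_assoc]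
  gcongr
  nlinarith
end

section
/- For every integer n ≥ 2, limsup_{H→∞} #F_n(H) / (2H)^{n+1} ≤ τ_n, where F_n(H) = {f ∈ E_n(H) : f(x+1) is an Eisenstein polynomial}. -/
open Polynomial Filter

/-- `τₙ = (∑_p (p-1)²/pⁿ⁺²)² - ∑_p (p-1)⁴/p²ⁿ⁺⁴`, the sums running over all primes. -/
noncomputable def tau (n : ℕ) : ℝ :=
  (∑' p : Nat.Primes, ((p : ℕ) - 1 : ℝ)^2 / ((p : ℕ) : ℝ)^(n + 2))^2
    - ∑' p : Nat.Primes, ((p : ℕ) - 1 : ℝ)^4 / ((p : ℕ) : ℝ)^(2*n + 4)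

/-- The coefficient vector of `f(x + 1)`, where `f` has coefficient vector `a`. -/
def shiftVec {R : Type*} [CommRing R] {n : ℕ} (a : Fin (n + 1) → R) : Fin (n + 1) → R :=
  fun j => ∑ i, a i * ((i : ℕ).choose j : R)

lemma coeff_taylor_one {R : Type*} [CommRing R] {n : ℕ} {f : R[X]} (hf : f.natDegree ≤ n)
    (j : ℕ) : (taylor 1 f).coeff j = ∑ i : Fin (n + 1), f.coeff i * ((i : ℕ).choose j : R) := by
  conv_lhs => rw [f.as_sum_range_C_mul_X_pow' (Nat.lt_succ_of_le hf)]
  simp only [map_sum, finsetSum_coeff]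
  rw [Finset.sum_range]
  refine Finset.sum_congr rfl fun i _ => ?_
  rw [taylor_mul, taylor_C, taylor_X_pow, coeff_C_mul, C_1, coeff_X_add_one_pow]

lemma shiftVec_injective {R : Type*} [CommRing R] {n : ℕ} :
    Function.Injective (shiftVec : (Fin (n + 1) → R) → Fin (n + 1) → R) := by
  intro a b hab
  let P : (Fin (n + 1) → R) → R[X] := fun a => ∑ i, C (a i) * X ^ (i : ℕ)
  have hdeg : ∀ a, (P a).natDegree ≤ n := fun a =>
    natDegree_sum_le_of_forall_le _ _ fun i _ =>
      (natDegree_C_mul_X_pow_le _ _).trans (Nat.lt_succ_iff.mp i.2)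
  have hcoeff : ∀ a (i : Fin (n + 1)), (P a).coeff i = a i := by
    intro a i
    simp [P, coeff_X_pow, Fin.val_inj]
  have hT : taylor 1 (P a) = taylor 1 (P b) := by
    ext j
    rw [coeff_taylor_one (hdeg a), coeff_taylor_one (hdeg b)]
    simp only [hcoeff]
    by_cases hj : j < n + 1
    · exact congrFun hab ⟨j, hj⟩
    · refine Finset.sum_congr rfl fun i _ => ?_
      rw [Nat.choose_eq_zero_of_lt (by omega : (i : ℕ) < j)]
      simp
  have hP := taylor_injective 1 hT
  ext i
  rw [← hcoeff a, ← hcoeff b, hP]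

/-- The Eisenstein condition at `p`, read on the coefficient vector. -/
def EisensteinVec {n : ℕ} (p : ℕ) (a : Fin (n + 1) → ℤ) : Prop :=
  (∀ i, i ≠ Fin.last n → (p : ℤ) ∣ a i) ∧ ¬ (p : ℤ) ^ 2 ∣ a 0 ∧ ¬ (p : ℤ) ∣ a (Fin.last n)

lemma IsEisensteinWith.eisensteinVec {n p : ℕ} {f : ℤ[X]} (h : IsEisensteinWith f p)
    (hf : f.natDegree = n) : EisensteinVec p (fun i : Fin (n + 1) => f.coeff i) := by
  refine ⟨fun i hi => h.1 i ?_, h.2.1, ?_⟩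
  · have := i.2
    have : (i : ℕ) ≠ n := fun e => hi (Fin.ext e)
    omega
  · have := h.2.2
    rwa [leadingCoeff, hf] at this

lemma EisensteinVec.ne_of_shiftVec {n p q : ℕ} (hn : n ≠ 0) {a : Fin (n + 1) → ℤ}
    (hp : EisensteinVec p a) (hq : EisensteinVec q (shiftVec a)) : p ≠ q := by
  rintro rfl
  have h0 : (0 : Fin (n + 1)) ≠ Fin.last n := by
    intro h
    exact hn (by simpa using (congrArg Fin.val h).symm)
  have h := hq.1 0 h0
  have hs : shiftVec a 0 = ∑ i : Fin n, a i.castSucc + a (Fin.last n) := by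
    simp [shiftVec, Fin.sum_univ_castSucc]
  rw [hs] at h
  exact hp.2.2 ((dvd_add_right (Finset.dvd_sum fun i _ =>
    hp.1 _ (Fin.castSucc_ne_last i))).mp h)

/-- The integer vectors of length `n + 1` with entries bounded by `H` in absolute value. -/
noncomputable def coeffBox (n H : ℕ) : Finset (Fin (n + 1) → ℤ) :=
  Fintype.piFinset fun _ => Finset.Icc (-(H : ℤ)) H

lemma mem_coeffBox {n H : ℕ} {a : Fin (n + 1) → ℤ} : a ∈ coeffBox n H ↔ ∀ i, |a i| ≤ H := by
  simp [coeffBox, abs_le]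

lemma shiftVec_mem_coeffBox {n H : ℕ} {a : Fin (n + 1) → ℤ} (ha : a ∈ coeffBox n H) :
    shiftVec a ∈ coeffBox n ((n + 1) * 2 ^ n * H) := by
  rw [mem_coeffBox] at ha ⊢
  intro j
  calc |shiftVec a j| ≤ ∑ i, |a i * ((i : ℕ).choose j : ℤ)| := Finset.abs_sum_le_sum_abs _ _
    _ ≤ ∑ i : Fin (n + 1), (H : ℤ) * 2 ^ n := by
        refine Finset.sum_le_sum fun i _ => ?_
        rw [abs_mul, Nat.abs_cast]
        have h1 : ((i : ℕ).choose j) ≤ 2 ^ n :=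
          (Nat.choose_le_two_pow _ _).trans
            (Nat.pow_le_pow_right (by norm_num) (Nat.lt_succ_iff.mp i.2))
        exact mul_le_mul (ha i) (by exact_mod_cast h1) (by positivity) (by positivity)
    _ = _ := by simp; ring

open Classical in
lemma card_Icc_filter_modEq_le (H N : ℕ) (hN : 0 < N) (v : ℤ) :
    (((Finset.Icc (-(H : ℤ)) H).filter (fun x => x ≡ v [ZMOD N])).card : ℝ)
      ≤ (2 * H + 1) / N + 1 := by
  have h := Int.Ioc_filter_modEq_card (-(H : ℤ) - 1) H (r := N) (by exact_mod_cast hN) v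
  have hI : Finset.Icc (-(H : ℤ)) H = Finset.Ioc (-(H : ℤ) - 1) H := by
    ext x; simp
  have hr : ((⌊(((H : ℤ) - v : ℤ) / ((N : ℤ) : ℚ) : ℚ)⌋ -
      ⌊((-(H : ℤ) - 1 - v : ℤ) / ((N : ℤ) : ℚ) : ℚ)⌋ : ℤ) : ℚ) ≤ (2 * H + 1) / N + 1 := by
    have h1 := Int.floor_le ((((H : ℤ) - v : ℤ) / ((N : ℤ) : ℚ) : ℚ))
    have h2 := Int.lt_floor_add_one (((-(H : ℤ) - 1 - v : ℤ) / ((N : ℤ) : ℚ) : ℚ))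
    have h3 : ((((H : ℤ) - v : ℤ) / ((N : ℤ) : ℚ) : ℚ)) -
        (((-(H : ℤ) - 1 - v : ℤ) / ((N : ℤ) : ℚ) : ℚ)) = (2 * H + 1) / N := by
      push_cast; ring
    push_cast at *
    linarith
  have h0 : (0 : ℚ) ≤ (2 * H + 1) / N + 1 := by positivity
  have hq : (((Finset.Icc (-(H : ℤ)) H).filter (fun x => x ≡ v [ZMOD N])).card : ℚ)
      ≤ (2 * H + 1) / N + 1 := by
    rw [hI]
    have h' : (((Finset.Ioc (-(H : ℤ) - 1) H).filter (fun x => x ≡ v [ZMOD N])).card : ℚ) =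
      ((max (⌊(((H : ℤ) - v : ℤ) / ((N : ℤ) : ℚ) : ℚ)⌋ -
      ⌊((-(H : ℤ) - 1 - v : ℤ) / ((N : ℤ) : ℚ) : ℚ)⌋) 0 : ℤ) : ℚ) := by
      push_cast at h ⊢
      rw [← Int.cast_natCast]
      convert congrArg (Int.cast : ℤ → ℚ) h using 1
      push_cast
      rfl
    rw [h', Int.cast_max]
    exact max_le hr (by simpa using h0)
  have := (Rat.cast_le (K := ℝ)).mpr hq
  push_cast at this
  exact this

open Classical in
lemma card_filter_dvd_zmod_sq {p : ℕ} [NeZero (p ^ 2)] (hp : p.Prime) :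
    (Finset.univ.filter fun x : ZMod (p ^ 2) => (p : ZMod (p ^ 2)) ∣ x).card = p := by
  have himg : (Finset.univ.filter fun x : ZMod (p ^ 2) => (p : ZMod (p ^ 2)) ∣ x) =
      (Finset.range p).image fun k : ℕ => ((p * k : ℕ) : ZMod (p ^ 2)) := by
    ext x
    simp only [Finset.mem_filter, Finset.mem_univ, true_and, Finset.mem_image, Finset.mem_range]
    constructor
    · rintro ⟨y, rfl⟩
      refine ⟨y.val % p, Nat.mod_lt _ hp.pos, ?_⟩
      conv_rhs => rw [← ZMod.natCast_zmod_val y, ← Nat.cast_mul]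
      rw [ZMod.natCast_eq_natCast_iff]
      have h := (Nat.mod_modEq y.val p).mul_left' p
      rwa [← pow_two] at h
    · rintro ⟨k, -, rfl⟩
      exact ⟨k, by push_cast; rfl⟩
  rw [himg, Finset.card_image_of_injOn, Finset.card_range]
  intro k hk l hl h
  simp only [Finset.coe_range, Set.mem_Iio] at hk hl
  have h' := (ZMod.natCast_eq_natCast_iff _ _ _).mp h
  rw [pow_two] at h'
  exact (Nat.ModEq.mul_left_cancel' hp.ne_zero h').eq_of_lt_of_lt hk hl

open Classical in
/-- The coefficient vectors modulo `p²` of polynomials that are Eisenstein at `p`. -/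
noncomputable def eisensteinResidues (n p : ℕ) [NeZero (p ^ 2)] :
    Finset (Fin (n + 1) → ZMod (p ^ 2)) :=
  Fintype.piFinset fun i =>
    if i = Fin.last n then Finset.univ.filter fun x => ¬ (p : ZMod (p ^ 2)) ∣ x
    else if i = 0 then (Finset.univ.filter fun x => (p : ZMod (p ^ 2)) ∣ x).erase 0
    else Finset.univ.filter fun x => (p : ZMod (p ^ 2)) ∣ x

lemma card_eisensteinResidues {n p : ℕ} [NeZero (p ^ 2)] (hn : n ≠ 0) (hp : p.Prime) :
    ((eisensteinResidues n p).card : ℝ) = (p - 1) ^ 2 * p ^ n := by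
  classical
  obtain ⟨m, rfl⟩ := Nat.exists_eq_succ_of_ne_zero hn
  have h1 := card_filter_dvd_zmod_sq hp
  have h2 : ((Finset.univ.filter fun x : ZMod (p ^ 2) => (p : ZMod (p ^ 2)) ∣ x).erase 0).card
      = p - 1 := by
    rw [Finset.card_erase_of_mem (by simp), h1]
  have h3 : (Finset.univ.filter fun x : ZMod (p ^ 2) => ¬ (p : ZMod (p ^ 2)) ∣ x).card
      + p = p ^ 2 := by
    have := Finset.card_filter_add_card_filter_not (s := (Finset.univ : Finset (ZMod (p ^ 2))))
      (fun x => (p : ZMod (p ^ 2)) ∣ x)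
    rw [h1, Finset.card_univ, ZMod.card] at this
    omega
  have h3' : ((Finset.univ.filter fun x : ZMod (p ^ 2) => ¬ (p : ZMod (p ^ 2)) ∣ x).card : ℝ)
      = p ^ 2 - p := by
    rw [eq_sub_iff_add_eq]
    exact_mod_cast h3
  have e0 : (0 : Fin (m + 1 + 1)) ≠ Fin.last (m + 1) := (Fin.last_pos).ne
  have e1 : ∀ i : Fin m, i.castSucc.succ ≠ Fin.last (m + 1) := fun i => by
    rw [← Fin.succ_last]
    exact fun h => Fin.castSucc_ne_last i (Fin.succ_injective _ h)
  rw [eisensteinResidues, Fintype.card_piFinset, Fin.prod_univ_succ, Fin.prod_univ_castSucc]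
  rw [if_neg e0, if_pos rfl, h2, Fin.succ_last, if_pos rfl]
  simp only [if_neg (e1 _), if_neg (Fin.succ_ne_zero _), h1, Finset.prod_const, Finset.card_univ,
    Fintype.card_fin]
  push_cast [Nat.cast_sub hp.one_le]
  rw [h3', Nat.succ_eq_add_one]
  ring

lemma natCast_dvd_intCast_zmod_sq {p : ℕ} {a : ℤ} :
    (p : ZMod (p ^ 2)) ∣ (a : ZMod (p ^ 2)) ↔ (p : ℤ) ∣ a := by
  constructor
  · rintro ⟨y, hy⟩
    obtain ⟨z, rfl⟩ := ZMod.intCast_surjective y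
    have h : ((a - p * z : ℤ) : ZMod (p ^ 2)) = 0 := by
      push_cast
      rw [hy, sub_self]
    rw [ZMod.intCast_zmod_eq_zero_iff_dvd] at h
    push_cast at h
    have h2 : (p : ℤ) ∣ a - p * z := (Dvd.intro_left _ (by ring : (p : ℤ) * p = p ^ 2)).trans h
    exact (dvd_sub_left (dvd_mul_right _ _)).mp h2
  · rintro ⟨z, rfl⟩
    exact ⟨z, by push_cast; rfl⟩

lemma EisensteinVec.mem_residues {n p : ℕ} [NeZero (p ^ 2)] {a : Fin (n + 1) → ℤ}
    (h : EisensteinVec p a) : (fun i => (a i : ZMod (p ^ 2))) ∈ eisensteinResidues n p := by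
  rw [eisensteinResidues, Fintype.mem_piFinset]
  intro i
  split_ifs with h1 h2
  · simp only [Finset.mem_filter, Finset.mem_univ, true_and]
    rw [natCast_dvd_intCast_zmod_sq, h1]
    exact h.2.2
  · subst h2
    simp only [Finset.mem_erase, Finset.mem_filter, Finset.mem_univ, true_and]
    rw [natCast_dvd_intCast_zmod_sq, Ne, ZMod.intCast_zmod_eq_zero_iff_dvd]
    exact ⟨by exact_mod_cast h.2.1, h.1 _ h1⟩
  · simp only [Finset.mem_filter, Finset.mem_univ, true_and]
    rw [natCast_dvd_intCast_zmod_sq]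
    exact h.1 _ h1

lemma shiftVec_intCast {R : Type*} [CommRing R] {n : ℕ} (a : Fin (n + 1) → ℤ) :
    shiftVec (fun i => (a i : R)) = fun i => ((shiftVec a i : ℤ) : R) := by
  ext j
  simp [shiftVec]

open Classical in
lemma card_eisenstein_pair_le {n p q : ℕ} (hn : n ≠ 0) (hp : p.Prime) (hq : q.Prime)
    (hpq : p ≠ q) (H : ℕ) :
    (((coeffBox n H).filter fun a => EisensteinVec p a ∧ EisensteinVec q (shiftVec a)).card : ℝ)
      ≤ ((2 * H + 1) / (p ^ 2 * q ^ 2) + 1) ^ (n + 1) *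
        (((p - 1) ^ 2 * p ^ n) * ((q - 1) ^ 2 * q ^ n)) := by
  have : NeZero (p ^ 2) := ⟨pow_ne_zero _ hp.ne_zero⟩
  have : NeZero (q ^ 2) := ⟨pow_ne_zero _ hq.ne_zero⟩
  have hcop : Nat.Coprime (p ^ 2) (q ^ 2) :=
    Nat.Coprime.pow _ _ ((Nat.coprime_primes hp hq).mpr hpq)
  set G := (coeffBox n H).filter fun a => EisensteinVec p a ∧ EisensteinVec q (shiftVec a)
  let red : (Fin (n + 1) → ℤ) → (Fin (n + 1) → ZMod (p ^ 2)) × (Fin (n + 1) → ZMod (q ^ 2)) :=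
    fun a => (fun i => (a i : ZMod (p ^ 2)), shiftVec fun i => (a i : ZMod (q ^ 2)))
  have hmaps : (G : Set (Fin (n + 1) → ℤ)).MapsTo red
      ((eisensteinResidues n p ×ˢ eisensteinResidues n q : Finset _) : Set _) := by
    intro a ha
    have ha := (Finset.mem_filter.mp (Finset.mem_coe.mp ha)).2
    rw [Finset.mem_coe, Finset.mem_product]
    refine ⟨ha.1.mem_residues, ?_⟩
    change shiftVec (fun i => (a i : ZMod (q ^ 2))) ∈ _
    rw [shiftVec_intCast]
    exact ha.2.mem_residues
  have hfib : ∀ b ∈ eisensteinResidues n p ×ˢ eisensteinResidues n q,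
      ((G.filter fun a => red a = b).card : ℝ) ≤ ((2 * H + 1) / (p ^ 2 * q ^ 2) + 1) ^ (n + 1) := by
    intro b _
    rcases (G.filter fun a => red a = b).eq_empty_or_nonempty with h0 | ⟨c, hc⟩
    · rw [h0, Finset.card_empty, Nat.cast_zero]
      positivity
    have hcb := (Finset.mem_filter.mp hc).2
    have hsub : (G.filter fun a => red a = b) ⊆ Fintype.piFinset fun i =>
        (Finset.Icc (-(H : ℤ)) H).filter fun x => x ≡ c i [ZMOD (p ^ 2 * q ^ 2 : ℕ)] := by
      intro a ha
      obtain ⟨haG, hab⟩ := Finset.mem_filter.mp ha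
      have hbox := (Finset.mem_filter.mp haG).1
      have hac : red a = red c := hab.trans hcb.symm
      have e1 := congrFun (congrArg Prod.fst hac)
      have e2 := congrFun (shiftVec_injective (congrArg Prod.snd hac))
      rw [Fintype.mem_piFinset]
      intro i
      rw [Finset.mem_filter]
      refine ⟨Fintype.mem_piFinset.mp hbox i, ?_⟩
      rw [Nat.cast_mul]
      exact (Int.modEq_and_modEq_iff_modEq_mul (by simpa using hcop)).mp
        ⟨(ZMod.intCast_eq_intCast_iff _ _ _).mp (e1 i),
          (ZMod.intCast_eq_intCast_iff _ _ _).mp (e2 i)⟩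
    calc ((G.filter fun a => red a = b).card : ℝ) ≤ _ :=
          Nat.cast_le.mpr (Finset.card_le_card hsub)
      _ = ∏ i : Fin (n + 1), (((Finset.Icc (-(H : ℤ)) H).filter
            fun x => x ≡ c i [ZMOD (p ^ 2 * q ^ 2 : ℕ)]).card : ℝ) := by
          rw [Fintype.card_piFinset, Nat.cast_prod]
      _ ≤ ∏ _i : Fin (n + 1), ((2 * H + 1) / (p ^ 2 * q ^ 2) + 1 : ℝ) := by
          refine Finset.prod_le_prod (fun _ _ => Nat.cast_nonneg _) fun i _ => ?_
          have := card_Icc_filter_modEq_le H (p ^ 2 * q ^ 2)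
            (Nat.mul_pos (NeZero.pos _) (NeZero.pos _)) (c i)
          push_cast at this ⊢
          exact this
      _ = _ := by simp
  rw [Finset.card_eq_sum_card_fiberwise hmaps, Nat.cast_sum]
  refine (Finset.sum_le_sum hfib).trans_eq ?_
  rw [Finset.sum_const, Finset.card_product, nsmul_eq_mul, Nat.cast_mul,
    card_eisensteinResidues hn hp, card_eisensteinResidues hn hq, mul_comm]

open Classical in
lemma card_large_prime_le {n M : ℕ} (hn : 2 ≤ n) (hM : 0 < M) (H : ℕ) :
    (((coeffBox n H).filter fun a => ∃ p, M < p ∧ p.Prime ∧ EisensteinVec p a).card : ℝ)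
      ≤ (3 * H) ^ (n + 1) / M := by
  have h0 : (0 : Fin (n + 1)) ≠ Fin.last n := by
    intro h
    have : 0 = n := by simpa using congrArg Fin.val h
    omega
  set D : ℕ → Finset (Fin (n + 1) → ℤ) := fun p => Fintype.piFinset fun i =>
    if i = Fin.last n then Finset.Icc (-(H : ℤ)) H
    else (Finset.Icc (-(H : ℤ)) H).filter fun x => x ≡ 0 [ZMOD p] with hD
  have hsub : ((coeffBox n H).filter fun a => ∃ p, M < p ∧ p.Prime ∧ EisensteinVec p a) ⊆
      (Finset.Ioc M H).biUnion D := by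
    intro a ha
    obtain ⟨hbox, p, hMp, hp, hE⟩ := Finset.mem_filter.mp ha
    have hpH : p ≤ H := by
      have ha0 : a 0 ≠ 0 := fun h => hE.2.1 (h ▸ dvd_zero _)
      have h1 := Int.le_of_dvd (abs_pos.mpr ha0) ((dvd_abs _ _).mpr (hE.1 0 h0))
      exact_mod_cast h1.trans (mem_coeffBox.mp hbox 0)
    rw [Finset.mem_biUnion]
    refine ⟨p, Finset.mem_Ioc.mpr ⟨hMp, hpH⟩, ?_⟩
    rw [hD, Fintype.mem_piFinset]
    intro i
    have hi := Fintype.mem_piFinset.mp hbox i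
    split_ifs with h
    · exact hi
    · exact Finset.mem_filter.mpr ⟨hi, (Int.modEq_zero_iff_dvd).mpr (hE.1 i h)⟩
  have hcard : ∀ p ∈ Finset.Ioc M H, ((D p).card : ℝ) ≤ (3 * H) ^ (n + 1) * ((p : ℝ) ^ 2)⁻¹ := by
    intro p hp
    obtain ⟨hMp, hpH⟩ := Finset.mem_Ioc.mp hp
    have hp1 : (1 : ℝ) ≤ p := by exact_mod_cast (by omega : 1 ≤ p)
    have hpH' : (p : ℝ) ≤ H := by exact_mod_cast hpH
    have hm : (((Finset.Icc (-(H : ℤ)) H).filter fun x => x ≡ 0 [ZMOD p]).card : ℝ)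
        ≤ 3 * H / p := by
      have hodd : (((Finset.Icc (-(H : ℤ)) H).filter fun x => x ≡ 0 [ZMOD p]).card : ℝ)
          ≤ 2 * (H / p : ℕ) + 1 := by
        have hs : ((Finset.Icc (-(H : ℤ)) H).filter fun x => x ≡ 0 [ZMOD p]) ⊆
            (Finset.Icc (-((H / p : ℕ) : ℤ)) (H / p : ℕ)).image fun k => p * k := by
          intro x hx
          obtain ⟨hx, hd⟩ := Finset.mem_filter.mp hx
          obtain ⟨k, rfl⟩ := Int.modEq_zero_iff_dvd.mp hd
          have hpz : (0 : ℤ) < p := by exact_mod_cast (by omega : 0 < p)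
          rw [Finset.mem_Icc] at hx
          refine Finset.mem_image.mpr ⟨k, Finset.mem_Icc.mpr ⟨?_, ?_⟩, rfl⟩
          · rw [neg_le]
            push_cast
            rw [Int.le_ediv_iff_mul_le hpz]
            linarith
          · push_cast
            rw [Int.le_ediv_iff_mul_le hpz]
            linarith
        have := (Finset.card_le_card hs).trans Finset.card_image_le
        rw [Int.card_Icc] at this
        have h' : (((H / p : ℕ) : ℤ) + 1 - -((H / p : ℕ) : ℤ)).toNat = 2 * (H / p) + 1 := by
          omega
        rw [h'] at this
        exact_mod_cast this
      have h1 : ((H / p : ℕ) : ℝ) ≤ H / p := Nat.cast_div_le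
      have h2 : (1 : ℝ) ≤ H / p := by rwa [le_div_iff₀ (by linarith), one_mul]
      calc _ ≤ _ := hodd
        _ ≤ 3 * ((H : ℝ) / p) := by linarith
        _ = _ := by ring
    have hall : ((Finset.Icc (-(H : ℤ)) H).card : ℝ) ≤ 3 * H := by
      have h' : ((H : ℤ) + 1 - -(H : ℤ)).toNat = 2 * H + 1 := by omega
      rw [Int.card_Icc, h']
      push_cast
      linarith
    have hDc : ((D p).card : ℝ) =
        (((Finset.Icc (-(H : ℤ)) H).filter fun x => x ≡ 0 [ZMOD p]).card : ℝ) ^ n *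
          ((Finset.Icc (-(H : ℤ)) H).card : ℝ) := by
      rw [hD, Fintype.card_piFinset, Fin.prod_univ_castSucc]
      simp only [if_neg (Fin.castSucc_ne_last _), if_true, Finset.prod_const, Finset.card_univ,
        Fintype.card_fin]
      push_cast
      rfl
    rw [hDc]
    calc _ ≤ (3 * H / p : ℝ) ^ n * (3 * H) := by gcongr
      _ = (3 * H) ^ (n + 1) * ((p : ℝ) ^ n)⁻¹ := by rw [div_pow]; ring
      _ ≤ _ := by gcongr
  calc _ ≤ (((Finset.Ioc M H).biUnion D).card : ℝ) := Nat.cast_le.mpr (Finset.card_le_card hsub)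
    _ ≤ ∑ p ∈ Finset.Ioc M H, ((D p).card : ℝ) := by exact_mod_cast Finset.card_biUnion_le
    _ ≤ ∑ p ∈ Finset.Ioc M H, (3 * H : ℝ) ^ (n + 1) * ((p : ℝ) ^ 2)⁻¹ := Finset.sum_le_sum hcard
    _ = (3 * H : ℝ) ^ (n + 1) * ∑ p ∈ Finset.Ioc M H, ((p : ℝ) ^ 2)⁻¹ := by rw [Finset.mul_sum]
    _ ≤ (3 * H : ℝ) ^ (n + 1) * (M : ℝ)⁻¹ := by
        gcongr
        rcases le_total M H with h | h
        · have h2 := sum_Ioc_inv_sq_le_sub (α := ℝ) hM.ne' h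
          have : (0 : ℝ) ≤ (H : ℝ)⁻¹ := by positivity
          linarith
        · rw [Finset.Ioc_eq_empty_of_le h]
          simp
    _ = _ := by rw [div_eq_mul_inv]

/-- The density of the integer polynomials of degree `n` that are Eisenstein at `p`. -/
noncomputable def eisensteinDensity (n p : ℕ) : ℝ := ((p : ℝ) - 1) ^ 2 / (p : ℝ) ^ (n + 2)

lemma eisensteinDensity_nonneg (n p : ℕ) : 0 ≤ eisensteinDensity n p := by
  unfold eisensteinDensity; positivity

lemma eisensteinDensity_le {n p : ℕ} (hn : 2 ≤ n) (hp : p.Prime) :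
    eisensteinDensity n p ≤ 1 / (p : ℝ) ^ 2 := by
  have h1 : (1 : ℝ) ≤ p := by exact_mod_cast hp.one_le
  unfold eisensteinDensity
  rw [div_le_div_iff₀ (by positivity) (by positivity), one_mul, add_comm n 2, pow_add,
    mul_comm]
  have h2 : ((p : ℝ) - 1) ^ 2 ≤ (p : ℝ) ^ 2 := by
    apply pow_le_pow_left₀ <;> linarith
  have h3 : (p : ℝ) ^ 2 ≤ (p : ℝ) ^ n := pow_le_pow_right₀ h1 hn
  calc _ ≤ (p : ℝ) ^ 2 * (p : ℝ) ^ 2 := by gcongr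
    _ ≤ _ := by gcongr

lemma summable_eisensteinDensity {n : ℕ} (hn : 2 ≤ n) :
    Summable fun p : Nat.Primes => eisensteinDensity n p :=
  Summable.of_nonneg_of_le (fun p => eisensteinDensity_nonneg n p)
    (fun p => eisensteinDensity_le hn p.2)
    ((Real.summable_one_div_nat_pow.mpr one_lt_two).comp_injective Nat.Primes.coe_nat_injective)

lemma summable_eisensteinDensity_sq {n : ℕ} (hn : 2 ≤ n) :
    Summable fun p : Nat.Primes => eisensteinDensity n p ^ 2 := by
  refine Summable.of_nonneg_of_le (fun p => sq_nonneg _) (fun p => ?_)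
    (summable_eisensteinDensity hn)
  have h0 := eisensteinDensity_nonneg n p
  have h1 : (1 : ℝ) ≤ (p : ℕ) := by exact_mod_cast p.2.one_le
  have h2 : eisensteinDensity n p ≤ 1 :=
    (eisensteinDensity_le hn p.2).trans (div_le_one_of_le₀ (one_le_pow₀ h1) (by positivity))
  nlinarith

lemma tau_eq (n : ℕ) : tau n = (∑' p : Nat.Primes, eisensteinDensity n p) ^ 2 -
    ∑' p : Nat.Primes, eisensteinDensity n p ^ 2 := by
  have h : ∀ p : Nat.Primes, eisensteinDensity n p ^ 2 =
      (((p : ℕ) : ℝ) - 1) ^ 4 / ((p : ℕ) : ℝ) ^ (2 * n + 4) := by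
    intro p
    rw [eisensteinDensity, div_pow, ← pow_mul, ← pow_mul]
    congr 2
    ring
  simp only [h]
  rfl

lemma sum_offDiag_mul {ι : Type*} [DecidableEq ι] (s : Finset ι) (f : ι → ℝ) :
    ∑ x ∈ s.offDiag, f x.1 * f x.2 = (∑ i ∈ s, f i) ^ 2 - ∑ i ∈ s, f i ^ 2 := by
  rw [eq_sub_iff_add_eq', pow_two, Finset.sum_mul_sum, ← Finset.sum_product',
    ← Finset.diag_union_offDiag, Finset.sum_union (Finset.disjoint_diag_offDiag s),
    Finset.sum_diag]
  simp only [pow_two]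

lemma tendsto_sum_offDiag_tau {n : ℕ} (hn : 2 ≤ n) :
    Tendsto (fun s : Finset Nat.Primes => ∑ x ∈ s.offDiag,
      eisensteinDensity n x.1 * eisensteinDensity n x.2) atTop (nhds (tau n)) := by
  rw [tau_eq]
  simp only [sum_offDiag_mul _ fun p : Nat.Primes => eisensteinDensity n p]
  exact ((summable_eisensteinDensity hn).hasSum.pow 2).sub
    (summable_eisensteinDensity_sq hn).hasSum

lemma tendsto_pair_bound {n p q : ℕ} (hp : p.Prime) (hq : q.Prime) :
    Tendsto (fun H : ℕ => ((2 * H + 1 : ℝ) / (p ^ 2 * q ^ 2) + 1) ^ (n + 1) *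
        (((p - 1) ^ 2 * p ^ n) * ((q - 1) ^ 2 * q ^ n)) / (2 * (H : ℝ)) ^ (n + 1)) atTop
      (nhds (eisensteinDensity n p * eisensteinDensity n q)) := by
  have hp0 : (p : ℝ) ≠ 0 := by exact_mod_cast hp.ne_zero
  have hq0 : (q : ℝ) ≠ 0 := by exact_mod_cast hq.ne_zero
  set N : ℝ := (p : ℝ) ^ 2 * (q : ℝ) ^ 2 with hN
  have hN0 : N ≠ 0 := by positivity
  have h1 : Tendsto (fun H : ℕ => 1 / N + (1 / N + 1) / 2 * (1 / (H : ℝ))) atTop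
      (nhds (1 / N)) := by
    simpa using (tendsto_const_nhds (x := 1 / N)).add
      (tendsto_one_div_atTop_nhds_zero_nat (𝕜 := ℝ) |>.const_mul ((1 / N + 1) / 2))
  have h2 := ((h1.pow (n + 1)).mul_const
    ((((p : ℝ) - 1) ^ 2 * p ^ n) * (((q : ℝ) - 1) ^ 2 * q ^ n)))
  have hlim : (1 / N) ^ (n + 1) * ((((p : ℝ) - 1) ^ 2 * p ^ n) * (((q : ℝ) - 1) ^ 2 * q ^ n)) =
      eisensteinDensity n p * eisensteinDensity n q := by
    rw [hN, eisensteinDensity, eisensteinDensity, div_mul_div_comm, one_div, inv_pow,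
      inv_mul_eq_div, div_eq_div_iff (by positivity) (by positivity)]
    ring
  rw [hlim] at h2
  refine h2.congr' ?_
  filter_upwards [eventually_gt_atTop 0] with H hH
  have hH' : (H : ℝ) ≠ 0 := by exact_mod_cast hH.ne'
  rw [mul_div_right_comm, ← div_pow]
  congr 2
  field_simp
  ring

open Classical in
/-- Coefficient vectors in the box which are Eisenstein, and whose shift is Eisenstein. -/
noncomputable def shiftedEisensteinVecs (n H : ℕ) : Finset (Fin (n + 1) → ℤ) :=
  (coeffBox n H).filter fun a =>
    ∃ p q : ℕ, p.Prime ∧ q.Prime ∧ EisensteinVec p a ∧ EisensteinVec q (shiftVec a)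

lemma card_shiftedEisenstein_le (n H : ℕ) :
    Nat.card {f ∈ EisensteinSet n H | IsEisenstein (f.comp (X + C 1))} ≤
      (shiftedEisensteinVecs n H).card := by
  classical
  have hmem : ∀ f ∈ {f ∈ EisensteinSet n H | IsEisenstein (f.comp (X + C 1))},
      (fun i : Fin (n + 1) => f.coeff i) ∈ shiftedEisensteinVecs n H := by
    rintro f ⟨⟨hdeg, hht, p, hp, hEp⟩, q, hq, hEq⟩
    refine Finset.mem_filter.mpr ⟨mem_coeffBox.mpr fun i => ?_, p, q, hp, hq,
      hEp.eisensteinVec hdeg, ?_⟩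
    · have h := (Finset.sup_le_iff.mp hht) i (Finset.mem_range.mpr (hdeg ▸ i.2))
      rw [Int.abs_eq_natAbs]
      exact_mod_cast h
    · rw [← taylor_apply] at hEq
      have hshift : shiftVec (fun i : Fin (n + 1) => f.coeff i) =
          fun i : Fin (n + 1) => (taylor 1 f).coeff i :=
        funext fun j => (coeff_taylor_one hdeg.le j).symm
      rw [hshift]
      exact hEq.eisensteinVec ((natDegree_taylor f 1).trans hdeg)
  rw [← Nat.card_eq_finsetCard]
  refine Nat.card_le_card_of_injective (fun f => ⟨_, hmem f.1 f.2⟩) fun f g hfg => ?_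
  have hcoeff := congrFun (congrArg Subtype.val hfg)
  refine Subtype.ext (Polynomial.ext fun i => ?_)
  by_cases hi : i < n + 1
  · exact hcoeff ⟨i, hi⟩
  · have hf : f.1.natDegree = n := f.2.1.1
    have hg : g.1.natDegree = n := g.2.1.1
    rw [coeff_eq_zero_of_natDegree_lt (by omega), coeff_eq_zero_of_natDegree_lt (by omega)]

open Classical in
lemma card_shiftedEisensteinVecs_le {n M : ℕ} (hn : 2 ≤ n) (hM : 0 < M) (H : ℕ)
    {s : Finset Nat.Primes} (hs : ∀ p : Nat.Primes, (p : ℕ) ≤ M → p ∈ s) :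
    ((shiftedEisensteinVecs n H).card : ℝ) ≤
      ∑ x ∈ s.offDiag, ((2 * H + 1 : ℝ) / ((x.1 : ℕ) ^ 2 * (x.2 : ℕ) ^ 2) + 1) ^ (n + 1) *
        ((((x.1 : ℕ) - 1) ^ 2 * (x.1 : ℕ) ^ n) * (((x.2 : ℕ) - 1) ^ 2 * (x.2 : ℕ) ^ n)) +
      ((3 * H) ^ (n + 1) / M + (3 * ((n + 1) * 2 ^ n * H)) ^ (n + 1) / M) := by
  set L : ℕ → Finset (Fin (n + 1) → ℤ) := fun H =>
    (coeffBox n H).filter fun a => ∃ p, M < p ∧ p.Prime ∧ EisensteinVec p a with hL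
  set Lshift : Finset (Fin (n + 1) → ℤ) :=
    (coeffBox n H).filter fun a => ∃ p, M < p ∧ p.Prime ∧ EisensteinVec p (shiftVec a) with hLshift
  set G : Nat.Primes × Nat.Primes → Finset (Fin (n + 1) → ℤ) := fun x =>
    (coeffBox n H).filter fun a => EisensteinVec x.1 a ∧ EisensteinVec x.2 (shiftVec a) with hG
  have hsub : shiftedEisensteinVecs n H ⊆ s.offDiag.biUnion G ∪ (L H ∪ Lshift) := by
    intro a ha
    obtain ⟨hbox, p, q, hp, hq, hEp, hEq⟩ := Finset.mem_filter.mp ha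
    rw [Finset.mem_union, Finset.mem_union]
    by_cases hpM : p ≤ M
    · by_cases hqM : q ≤ M
      · refine Or.inl (Finset.mem_biUnion.mpr ⟨(⟨p, hp⟩, ⟨q, hq⟩), ?_, ?_⟩)
        · refine Finset.mem_offDiag.mpr ⟨hs ⟨p, hp⟩ hpM, hs ⟨q, hq⟩ hqM, fun h => ?_⟩
          exact hEp.ne_of_shiftVec (by omega) hEq (congrArg Subtype.val h)
        · exact Finset.mem_filter.mpr ⟨hbox, hEp, hEq⟩
      · exact Or.inr (Or.inr (Finset.mem_filter.mpr ⟨hbox, q, not_le.mp hqM, hq, hEq⟩))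
    · exact Or.inr (Or.inl (Finset.mem_filter.mpr ⟨hbox, p, not_le.mp hpM, hp, hEp⟩))
  have hLshift_card : Lshift.card ≤ (L ((n + 1) * 2 ^ n * H)).card := by
    refine Finset.card_le_card_of_injOn shiftVec (fun a ha => ?_) shiftVec_injective.injOn
    obtain ⟨hbox, h⟩ := Finset.mem_filter.mp (Finset.mem_coe.mp ha)
    exact Finset.mem_coe.mpr (Finset.mem_filter.mpr ⟨shiftVec_mem_coeffBox hbox, h⟩)
  have h1 : (shiftedEisensteinVecs n H).card ≤
      ∑ x ∈ s.offDiag, (G x).card + ((L H).card + Lshift.card) :=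
    (Finset.card_le_card hsub).trans <| (Finset.card_union_le _ _).trans <|
      add_le_add Finset.card_biUnion_le (Finset.card_union_le _ _)
  have hbig := card_large_prime_le hn hM ((n + 1) * 2 ^ n * H)
  push_cast at hbig
  calc ((shiftedEisensteinVecs n H).card : ℝ) ≤
        ∑ x ∈ s.offDiag, ((G x).card : ℝ) +
          (((L H).card : ℝ) + ((L ((n + 1) * 2 ^ n * H)).card : ℝ)) := by
        exact_mod_cast h1.trans (by gcongr)
    _ ≤ _ := by
        refine add_le_add (Finset.sum_le_sum fun x hx => ?_)
          (add_le_add (card_large_prime_le hn hM H) hbig)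
        refine card_eisenstein_pair_le (by omega) x.1.2 x.2.2 (fun h => ?_) H
        exact (Finset.mem_offDiag.mp hx).2.2 (Subtype.ext h)

/-- For `n ≥ 2`: `limsup_{H→∞} #F_n(H)/(2H)ⁿ⁺¹ ≤ τₙ`, where
`F_n(H) = {f ∈ E_n(H) : f(x+1) is Eisenstein}`. -/
theorem limsup_card_Fset_le (n : ℕ) (hn : 2 ≤ n) :
    limsup (fun H : ℕ =>
        (Nat.card {f ∈ EisensteinSet n H | IsEisenstein (f.comp (X + C 1))} : ℝ) /
          (2 * (H : ℝ))^(n + 1)) atTop ≤ tau n := by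
  classical
  refine le_of_forall_pos_le_add fun ε hε => ?_
  refine limsup_le_of_le (isCoboundedUnder_le_of_le atTop fun H => by positivity) ?_
  set K : ℝ := (3 / 2) ^ (n + 1) + (3 * ((n + 1) * 2 ^ n) / 2) ^ (n + 1) with hK
  have hK0 : 0 < K := by positivity
  obtain ⟨M, hM⟩ := exists_nat_gt (K / (ε / 3))
  have hM0 : (0 : ℝ) < M := lt_trans (by positivity) hM
  have hKM : K / M ≤ ε / 3 := by
    rw [div_lt_iff₀ (by positivity)] at hM
    rw [div_le_iff₀ hM0]
    linarith
  obtain ⟨s, hsτ, hs⟩ := (((tendsto_sum_offDiag_tau hn).eventually_le_const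
    (by linarith : tau n < tau n + ε / 3)).and
      (eventually_ge_atTop (Finset.subtype Nat.Prime (Finset.range (M + 1))))).exists
  have hs' : ∀ p : Nat.Primes, (p : ℕ) ≤ M → p ∈ s := fun p hp =>
    hs (Finset.mem_subtype.mpr (Finset.mem_range.mpr (Nat.lt_succ_of_le hp)))
  have hlim := tendsto_finsetSum s.offDiag fun x _ =>
    tendsto_pair_bound (n := n) (x.1 : Nat.Primes).2 (x.2 : Nat.Primes).2
  filter_upwards [hlim.eventually_le_const (lt_add_of_pos_right _ (by positivity : 0 < ε / 3)),
    eventually_gt_atTop 0] with H hH hH0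
  have hH' : (0 : ℝ) < H := by exact_mod_cast hH0
  have hcard := (Nat.cast_le (α := ℝ).mpr (card_shiftedEisenstein_le n H)).trans
    (card_shiftedEisensteinVecs_le hn (by exact_mod_cast hM0) H hs')
  have htail : ((3 * H : ℝ) ^ (n + 1) / M + (3 * ((n + 1) * 2 ^ n * H)) ^ (n + 1) / M) /
      (2 * (H : ℝ)) ^ (n + 1) = K / M := by
    have e1 : (3 * H : ℝ) = 3 / 2 * (2 * H) := by ring
    have e2 : (3 * ((n + 1) * 2 ^ n * H) : ℝ) = 3 * ((n + 1) * 2 ^ n) / 2 * (2 * H) := by ring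
    rw [e1, e2, mul_pow, mul_pow _ (2 * (H : ℝ)), hK]
    field_simp
  calc _ ≤ _ := div_le_div_of_nonneg_right hcard (by positivity)
    _ ≤ (tau n + ε / 3 + ε / 3) + ε / 3 := by
        rw [add_div, htail, Finset.sum_div]
        linarith
    _ = _ := by ring
end
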